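/- The C_{2v}(R,R′,2p) branch of six-vortex relative equilibria (Section 3.2.2, second family, rings offset by π/2): Let λ_n ∈ ℝ and x, y ∈ (−1, 1). Consider the configuration of 6 vortices with positions P₁ = (√(1−x²), 0, x), P₂ = (−√(1−x²), 0, x) of vorticity +1, P₃ = (0, √(1−y²), y), P₄ = (0, −√(1−y²), y) of vorticity −1, the North pole (0,0,1) of vorticity λ_n and the South pole (0,0,−1) of vorticity −λ_n. Then there exists ξ ∈ ℝ with F(p) i = ξ • ((0,0,1) × p i) for all six vortices p i (i.e. the configuration is a relative equilibrium rotating about the z-axis) if and only if (y + x) · ( x²·y² − 2·y² − 2·x² + 2·x·y + 1 − 2·λ_n·(1 − x·y)·(x − y) ) = 0. -/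

import Mathlib

open scoped RealInnerProductSpace BigOperators

noncomputable section

/-- Euclidean 3-space. -/
abbrev R3 : Type := EuclideanSpace ℝ (Fin 3)

/-- The vector of `R3` with the given coordinates. -/
def v3 (a b c : ℝ) : R3 := (WithLp.equiv 2 (Fin 3 → ℝ)).symm ![a, b, c]

/-- Cross product on `R3`. -/
def cross (u v : R3) : R3 :=
  v3 (u 1 * v 2 - u 2 * v 1) (u 2 * v 0 - u 0 * v 2) (u 0 * v 1 - u 1 * v 0)

/-- The point-vortex vector field on the sphere:
`F(x) i = Σ_{j ≠ i} (λ j / (1 − ⟪x i, x j⟫)) • (x j × x i)`. -/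
def vortexF {ι : Type} [Fintype ι] [DecidableEq ι] (lam : ι → ℝ) (x : ι → R3) (i : ι) : R3 :=
  ∑ j ∈ Finset.univ.filter (fun j => j ≠ i), (lam j / (1 - ⟪x i, x j⟫)) • cross (x j) (x i)

/-- The point-vortex Hamiltonian `H(y) = Σ_{i<j} λ i λ j log ‖y i − y j‖²`. -/
def vortexH (n : ℕ) (lam : Fin n → ℝ) (y : Fin n → R3) : ℝ :=
  ∑ p ∈ Finset.univ.filter (fun p : Fin n × Fin n => p.1 < p.2),
    lam p.1 * lam p.2 * Real.log (‖y p.1 - y p.2‖ ^ 2)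

/-- The centre of vorticity `Φ(y) = Σ_i λ i • y i`. -/
def vorticityCentre (n : ℕ) (lam : Fin n → ℝ) (y : Fin n → R3) : R3 := ∑ i, lam i • y i

@[simp] lemma v3_apply_zero (a b c : ℝ) : v3 a b c 0 = a := rfl

@[simp] lemma v3_apply_one (a b c : ℝ) : v3 a b c 1 = b := rfl

@[simp] lemma v3_apply_two (a b c : ℝ) : v3 a b c 2 = c := rfl

lemma inner_v3 (a b c d e f : ℝ) :
    ⟪v3 a b c, v3 d e f⟫ = a * d + b * e + c * f := by
  simp [PiLp.inner_apply, Fin.sum_univ_three]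
  ring

lemma cross_v3 (a b c d e f : ℝ) :
    cross (v3 a b c) (v3 d e f) = v3 (b * f - c * e) (c * d - a * f) (a * e - b * d) := rfl

lemma smul_v3 (r a b c : ℝ) : r • v3 a b c = v3 (r * a) (r * b) (r * c) := by
  ext i; fin_cases i <;> rfl

lemma add_v3 (a b c d e f : ℝ) : v3 a b c + v3 d e f = v3 (a + d) (b + e) (c + f) := by
  ext i; fin_cases i <;> rfl

lemma v3_zero : v3 0 0 0 = 0 := by
  ext i; fin_cases i <;> rfl

lemma v3_inj {a b c d e f : ℝ} : v3 a b c = v3 d e f ↔ a = d ∧ b = e ∧ c = f := by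
  refine ⟨fun h => ⟨congrArg (fun v : R3 => v 0) h, congrArg (fun v : R3 => v 1) h,
    congrArg (fun v : R3 => v 2) h⟩, ?_⟩
  rintro ⟨rfl, rfl, rfl⟩
  rfl

/-- the `C_{2v}(R,R′,2p)` branch of six-vortex relative equilibria
(Section 3.2.2, second family, rings offset by `π/2`): the configuration is a relative
equilibrium about the `z`-axis iff
`(y + x)(x²y² − 2y² − 2x² + 2xy + 1 − 2λ_n(1 − xy)(x − y)) = 0`. -/
theorem C2v_RRp2p_relative_equilibrium_iff (lamn x y : ℝ)
    (hx : x ∈ Set.Ioo (-1 : ℝ) 1) (hy : y ∈ Set.Ioo (-1 : ℝ) 1)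
    (p : Fin 6 → R3) (lam : Fin 6 → ℝ)
    (hp : p = ![v3 (Real.sqrt (1 - x ^ 2)) 0 x, v3 (-Real.sqrt (1 - x ^ 2)) 0 x,
                v3 0 (Real.sqrt (1 - y ^ 2)) y, v3 0 (-Real.sqrt (1 - y ^ 2)) y,
                v3 0 0 1, v3 0 0 (-1)])
    (hlam : lam = ![1, 1, -1, -1, lamn, -lamn]) :
    (∃ ξ : ℝ, ∀ i, vortexF lam p i = ξ • cross (v3 0 0 1) (p i)) ↔
      (y + x) * (x ^ 2 * y ^ 2 - 2 * y ^ 2 - 2 * x ^ 2 + 2 * x * y + 1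
        - 2 * lamn * (1 - x * y) * (x - y)) = 0 := by
  obtain ⟨hx1, hx2⟩ := hx
  obtain ⟨hy1, hy2⟩ := hy
  have hX : 0 < 1 - x ^ 2 := by nlinarith
  have hY : 0 < 1 - y ^ 2 := by nlinarith
  have hXY : 0 < 1 - x * y := by nlinarith [sq_nonneg (x - y)]
  have hs : 0 < √(1 - x ^ 2) := Real.sqrt_pos.2 hX
  have ht : 0 < √(1 - y ^ 2) := Real.sqrt_pos.2 hY
  have hs2 : √(1 - x ^ 2) ^ 2 = 1 - x ^ 2 := Real.sq_sqrt hX.le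
  have ht2 : √(1 - y ^ 2) ^ 2 = 1 - y ^ 2 := Real.sq_sqrt hY.le
  generalize √(1 - x ^ 2) = s at *
  generalize √(1 - y ^ 2) = t at *
  have hself : 1 - (-(s * s) + x * x) = 2 * (1 - x ^ 2) := by linarith
  have hself' : 1 - (-(t * t) + y * y) = 2 * (1 - y ^ 2) := by linarith
  have hx1' : 1 + x ≠ 0 := by linarith
  have hx2' : 1 - x ≠ 0 := by linarith
  have hy1' : 1 + y ≠ 0 := by linarith
  have hy2' : 1 - y ≠ 0 := by linarith
  have hpole : lamn / (1 - x) + lamn / (1 + x) = 2 * lamn / (1 - x ^ 2) := by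
    rw [show 1 - x ^ 2 = (1 - x) * (1 + x) by ring]
    field_simp
    ring
  have hpole' : lamn / (1 - y) + lamn / (1 + y) = 2 * lamn / (1 - y ^ 2) := by
    rw [show 1 - y ^ 2 = (1 - y) * (1 + y) by ring]
    field_simp
    ring
  set a : ℝ := (x + 2 * lamn) / (1 - x ^ 2) - 2 * y / (1 - x * y) with ha
  set b : ℝ := (2 * lamn - y) / (1 - y ^ 2) + 2 * x / (1 - x * y) with hb
  have ha' : a = 2 * x * (1 / (2 * (1 - x ^ 2))) + 2 * y * (-1 / (1 - x * y))
      + (lamn / (1 - x) + lamn / (1 + x)) := by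
    rw [hpole, ha]
    field_simp
    ring
  have hb' : b = 2 * y * (-1 / (2 * (1 - y ^ 2))) + 2 * x * (1 / (1 - x * y))
      + (lamn / (1 - y) + lamn / (1 + y)) := by
    rw [hpole', hb]
    field_simp
    ring
  have hF : ∀ i, vortexF lam p i = (![a, a, b, b, 0, 0] i : ℝ) • cross (v3 0 0 1) (p i) := by
    subst hp hlam
    intro i
    rw [vortexF, Finset.sum_filter, Fin.sum_univ_six]
    fin_cases i <;>
      simp [inner_v3, cross_v3, smul_v3, add_v3, v3_inj, hself, hself', ha', hb',
        mul_comm y x] <;>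
      first | exact v3_zero | ring
  have hab : a = b ↔ (y + x) * (x ^ 2 * y ^ 2 - 2 * y ^ 2 - 2 * x ^ 2 + 2 * x * y + 1
        - 2 * lamn * (1 - x * y) * (x - y)) = 0 := by
    have key : (b - a) * ((1 - x ^ 2) * (1 - y ^ 2) * (1 - x * y)) =
        (y + x) * (x ^ 2 * y ^ 2 - 2 * y ^ 2 - 2 * x ^ 2 + 2 * x * y + 1
          - 2 * lamn * (1 - x * y) * (x - y)) := by
      have hX' := hX.ne'
      have hY' := hY.ne'
      have hXY' := hXY.ne'
      rw [ha, hb]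
      generalize hu : 1 - x ^ 2 = u at *
      generalize hv : 1 - y ^ 2 = v at *
      generalize hw : 1 - x * y = w at *
      field_simp
      subst u v w
      ring
    rw [← key, mul_eq_zero_iff_right (by positivity), sub_eq_zero, eq_comm]
  rw [← hab]
  constructor
  · rintro ⟨ξ, h⟩
    have h0 := (hF 0).symm.trans (h 0)
    have h2 := (hF 2).symm.trans (h 2)
    simp [hp, cross_v3, smul_v3, v3_inj, hs.ne', ht.ne'] at h0 h2
    rw [h0, h2]
  · intro h
    refine ⟨a, fun i => (hF i).trans ?_⟩
    fin_cases i <;> simp [hp, h, cross_v3, smul_v3, v3_zero]
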